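/- Under the stated hypotheses, and assuming additionally that β(t) → +∞ as t → +∞, one has lim_{t→∞} β(t) ψ(x(t)) = 0 and lim_{t→∞} ψ(x(t)) = 0. -/

import Mathlib

open Filter MeasureTheory Set RealInnerProductSpace

/-- The first-order inequality for a differentiable convex function. -/
theorem ConvexOn.add_inner_gradient_le {H : Type*} [NormedAddCommGroup H] [InnerProductSpace ℝ H]
    [CompleteSpace H] {f : H → ℝ} (hf : ConvexOn ℝ univ f) {u : H}
    (hd : DifferentiableAt ℝ f u) (v : H) : f u + ⟪gradient f u, v - u⟫ ≤ f v := by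
  have hconv : ConvexOn ℝ univ (f ∘ AffineMap.lineMap (k := ℝ) u v) := by
    simpa using hf.comp_affineMap (AffineMap.lineMap (k := ℝ) u v)
  have hderiv : HasDerivAt (f ∘ AffineMap.lineMap (k := ℝ) u v) (fderiv ℝ f u (v - u)) 0 := by
    refine HasFDerivAt.comp_hasDerivAt (0 : ℝ) ?_ AffineMap.hasDerivAt_lineMap
    simpa using hd.hasFDerivAt
  have hslope := hconv.le_slope_of_hasDerivAt (mem_univ 0) (mem_univ 1) one_pos hderiv
  rw [inner_gradient_left]
  simp only [slope_def_field, Function.comp_apply, AffineMap.lineMap_apply_one,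
    AffineMap.lineMap_apply_zero, sub_zero, div_one] at hslope
  linarith

/-- The variational inequality at a minimizer over a convex set. -/
theorem IsMinOn.inner_gradient_nonneg {H : Type*} [NormedAddCommGroup H] [InnerProductSpace ℝ H]
    [CompleteSpace H] {f : H → ℝ} {s : Set H} {u v : H} (hmin : IsMinOn f s u)
    (hs : Convex ℝ s) (hu : u ∈ s) (hv : v ∈ s) (hd : DifferentiableAt ℝ f u) :
    0 ≤ ⟪gradient f u, v - u⟫ := by
  rw [inner_gradient_left]
  exact hmin.localize.hasFDerivWithinAt_nonneg hd.hasFDerivAt.hasFDerivWithinAt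
    (sub_mem_posTangentConeAt_of_segment_subset (hs.segment_subset hu hv))

/-- A nonincreasing function on `[0, ∞)` with finite integral is finite on `(0, ∞)`,
integrable, and tends to zero. -/
theorem AntitoneOn.exists_integrableOn_tendsto_zero {g : ℝ → ENNReal}
    (hg : AntitoneOn g (Ici 0)) (hint : ∫⁻ t in Ici (0 : ℝ), g t ≠ ⊤) :
    ∃ r : ℝ → ℝ, (∀ t, 0 ≤ r t) ∧ (∀ t, 0 < t → g t = ENNReal.ofReal (r t)) ∧
      IntegrableOn r (Ioi 0) ∧ Tendsto r atTop (nhds 0) := by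
  set I := ∫⁻ t in Ici (0 : ℝ), g t with hI
  have hbound : ∀ t, 0 < t → g t ≤ I / ENNReal.ofReal t := by
    intro t ht
    rw [ENNReal.le_div_iff_mul_le (Or.inl (by simpa using ht)) (Or.inl ENNReal.ofReal_ne_top)]
    calc g t * ENNReal.ofReal t = ∫⁻ _ in Icc 0 t, g t := by simp
      _ ≤ ∫⁻ s in Icc 0 t, g s :=
        setLIntegral_mono' measurableSet_Icc fun s hs => hg hs.1 ht.le hs.2
      _ ≤ I := lintegral_mono_set Icc_subset_Ici_self
  have hfin : ∀ t, 0 < t → g t ≠ ⊤ := fun t ht =>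
    ((hbound t ht).trans_lt (ENNReal.div_lt_top hint (by simpa using ht))).ne
  refine ⟨fun t => (g t).toReal, fun t => ENNReal.toReal_nonneg,
    fun t ht => (ENNReal.ofReal_toReal (hfin t ht)).symm, ?_, ?_⟩
  · exact (integrable_toReal_of_lintegral_ne_top
      (aemeasurable_restrict_of_antitoneOn measurableSet_Ici hg) hint).mono_measure
      (Measure.restrict_mono Ioi_subset_Ici_self le_rfl)
  · have hlim : Tendsto (fun t : ℝ => I.toReal / t) atTop (nhds 0) :=
      tendsto_const_nhds.div_atTop tendsto_id
    refine squeeze_zero' (Eventually.of_forall fun t => ENNReal.toReal_nonneg) ?_ hlim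
    filter_upwards [eventually_gt_atTop 0] with t ht
    have := ENNReal.toReal_mono (ENNReal.div_lt_top hint (by simpa using ht)).ne (hbound t ht)
    simpa [ENNReal.toReal_div, ENNReal.toReal_ofReal ht.le] using this

/-- If `F` is bounded below and `F' ≤ -Q` where `Q` is nonnegative up to an integrable
perturbation, then `Q` is integrable. -/
theorem integrableOn_Ioi_of_hasDerivAt_le_neg {F F' Q r : ℝ → ℝ} {a m : ℝ}
    (hF : ∀ t, a ≤ t → HasDerivAt F (F' t) t) (hm : ∀ t, a ≤ t → m ≤ F t)
    (hQ : ContinuousOn Q (Ici a)) (hF' : ∀ t, a ≤ t → F' t ≤ -Q t)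
    (hr : IntegrableOn r (Ioi a)) (hr0 : ∀ t, 0 ≤ r t) (hQr : ∀ t, a ≤ t → 0 ≤ Q t + r t) :
    IntegrableOn Q (Ioi a) := by
  have hQi : ∀ T, IntegrableOn Q (Icc a T) := fun T =>
    (hQ.mono Icc_subset_Ici_self).integrableOn_Icc
  have hri : ∀ T, IntegrableOn r (Ioc a T) := fun T => hr.mono_set Ioc_subset_Ioi_self
  suffices h : IntegrableOn (fun t => Q t + r t) (Ioi a) by
    exact (h.sub hr).congr (Eventually.of_forall fun t => add_sub_cancel_right (Q t) (r t))
  refine integrableOn_Ioi_of_intervalIntegral_norm_bounded (b := id)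
    (F a - m + ∫ t in Ioi a, r t) a
    (fun T => ((hQi T).mono_set Ioc_subset_Icc_self).add (hri T)) tendsto_id ?_
  filter_upwards [eventually_ge_atTop a] with T hT
  have hle := intervalIntegral.sub_le_integral_of_hasDeriv_right_of_le hT
    (fun t ht => (hF t ht.1).continuousAt.continuousWithinAt)
    (fun t ht => (hF t ht.1.le).hasDerivWithinAt) (hQi T).neg (fun t ht => hF' t ht.1.le)
  have hnorm : ∫ t in a..T, ‖Q t + r t‖ = ∫ t in a..T, (Q t + r t) := by
    refine intervalIntegral.integral_congr fun t ht => ?_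
    rw [uIcc_of_le hT] at ht
    exact Real.norm_of_nonneg (hQr t ht.1)
  have hadd : ∫ t in a..T, (Q t + r t) = (∫ t in a..T, Q t) + ∫ t in a..T, r t :=
    intervalIntegral.integral_add
      ((intervalIntegrable_iff_integrableOn_Ioc_of_le hT).2
        ((hQi T).mono_set Ioc_subset_Icc_self))
      ((intervalIntegrable_iff_integrableOn_Ioc_of_le hT).2 (hri T))
  have hneg : ∫ t in a..T, (-Q) t = -∫ t in a..T, Q t := by
    simp only [Pi.neg_apply, intervalIntegral.integral_neg]
  have hrle : ∫ t in a..T, r t ≤ ∫ t in Ioi a, r t := by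
    rw [intervalIntegral.integral_of_le hT]
    exact setIntegral_mono_set hr (Eventually.of_forall hr0)
      (Eventually.of_forall Ioc_subset_Ioi_self)
  have := hm T hT
  simp only [id] at *
  rw [hneg] at hle
  rw [hnorm, hadd]
  linarith

theorem stmt10 {H : Type*} [NormedAddCommGroup H] [InnerProductSpace ℝ H] [CompleteSpace H]
    (φ ψ : H → ℝ) (γ k : ℝ) (β β' : ℝ → ℝ) (x x' x'' : ℝ → H)
    -- ψ is convex, Fréchet differentiable with Lipschitz continuous gradient,
    -- nonnegative, and argmin ψ = ψ⁻¹(0) is nonempty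
    (hψconv : ConvexOn ℝ univ ψ)
    (hψdiff : Differentiable ℝ ψ)
    (hψlip : ∃ L : NNReal, LipschitzWith L (gradient ψ))
    (hψnonneg : ∀ y, 0 ≤ ψ y)
    (hψmin : ∃ y, ψ y = 0)
    -- φ is convex, Fréchet differentiable with Lipschitz continuous gradient,
    -- bounded from below, and S = {z ∈ argmin ψ : φ z ≤ φ y ∀ y ∈ argmin ψ} is nonempty
    (hφconv : ConvexOn ℝ univ φ)
    (hφdiff : Differentiable ℝ φ)
    (hφlip : ∃ L : NNReal, LipschitzWith L (gradient φ))
    (hφbdd : BddBelow (range φ))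
    (hS : ∃ z : H, ψ z = 0 ∧ ∀ y, ψ y = 0 → φ z ≤ φ y)
    -- γ > 0, 0 ≤ k < γ, and β : [0,∞) → (0,∞) is a C¹ function (with derivative β')
    -- satisfying the growth condition 0 ≤ β' ≤ k β
    (hγ : 0 < γ) (hk : 0 ≤ k) (hkγ : k < γ)
    (hβpos : ∀ t ∈ Ici (0 : ℝ), 0 < β t)
    (hβderiv : ∀ t ∈ Ici (0 : ℝ), HasDerivWithinAt β (β' t) (Ici 0) t)
    (hβ'cont : ContinuousOn β' (Ici 0))
    (hβgrowth : ∀ t ∈ Ici (0 : ℝ), 0 ≤ β' t ∧ β' t ≤ k * β t)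
    -- condition (H): for every p in the range of the normal cone to argmin ψ (i.e.
    -- p ∈ N(z) for some z ∈ argmin ψ = ψ⁻¹(0)), the integral
    -- ∫_0^∞ β(t) [ψ*(p/β(t)) - σ(p/β(t))] dt is finite; here σ(p/β(t)) = ⟪p/β(t), z⟫
    -- since p ∈ N(z), and β(t)[ψ*(q) - ⟪q, z⟫] = ⨆ w, β(t)((⟪q, w⟫ - ψ w) - ⟪q, z⟫) ≥ 0.
    (hH : ∀ z p : H, ψ z = 0 → (∀ y, ψ y = 0 → ⟪p, y - z⟫ ≤ 0) →
      ∫⁻ t in Ici (0 : ℝ), ⨆ w : H,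
        ENNReal.ofReal (β t * ((⟪(β t)⁻¹ • p, w⟫ - ψ w) - ⟪(β t)⁻¹ • p, z⟫)) ≠ ⊤)
    -- x : [0,∞) → H is twice continuously differentiable (first derivative x',
    -- second derivative x'') and satisfies ẍ + γ ẋ + ∇φ(x) + β ∇ψ(x) = 0 on [0,∞)
    (hx' : ∀ t ∈ Ici (0 : ℝ), HasDerivWithinAt x (x' t) (Ici 0) t)
    (hx'' : ∀ t ∈ Ici (0 : ℝ), HasDerivWithinAt x' (x'' t) (Ici 0) t)
    (hx''cont : ContinuousOn x'' (Ici 0))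
    (hode : ∀ t ∈ Ici (0 : ℝ),
      x'' t + γ • x' t + gradient φ (x t) + β t • gradient ψ (x t) = 0)
    -- β(t) → +∞ as t → +∞
    (hβinf : Tendsto β atTop atTop) :
    Tendsto (fun t => β t * ψ (x t)) atTop (nhds 0) ∧
      Tendsto (fun t => ψ (x t)) atTop (nhds 0) := by
  obtain ⟨z, hz, hzmin⟩ := hS
  obtain ⟨mφ, hmφ⟩ := hφbdd
  have hφ_ge : ∀ y, mφ ≤ φ y := fun y => hmφ ⟨y, rfl⟩
  obtain ⟨a, hka, haγ⟩ := exists_between hkγ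
  have ha : 0 < a := hk.trans_lt hka
  obtain ⟨c, hc⟩ : ∃ c, c = (a - k) / (2 * a) := ⟨_, rfl⟩
  have hac : a * c = (a - k) / 2 := by rw [hc]; field_simp
  have hc0 : 0 < c := by rw [hc]; exact div_pos (by linarith) (by linarith)
  have hc1 : c ≤ 1 / 2 := by rw [hc, div_le_div_iff₀] <;> linarith
  have hβmono : MonotoneOn β (Ici 0) := by
    refine monotoneOn_of_hasDerivWithinAt_nonneg (f' := β') (convex_Ici 0)
      (fun t ht => (hβderiv t ht).continuousWithinAt) (fun t ht => ?_) fun t ht => ?_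
    · exact (hβderiv t (interior_subset ht)).mono interior_subset
    · exact (hβgrowth t (interior_subset ht)).1
  -- the normal vector `p = -∇φ(z) / c` and the function controlled by condition (H)
  have hargmin : Convex ℝ {y | ψ y = 0} := by
    have h := hψconv.convex_le 0
    convert h using 1
    ext y
    exact ⟨fun hy => ⟨mem_univ y, le_of_eq hy⟩, fun hy => le_antisymm hy.2 (hψnonneg y)⟩
  obtain ⟨p, hp⟩ : ∃ p, p = -(c⁻¹ • gradient φ z) := ⟨_, rfl⟩
  have hpN : ∀ y, ψ y = 0 → ⟪p, y - z⟫ ≤ 0 := by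
    intro y hy
    have hmin : IsMinOn φ {y | ψ y = 0} z := fun y hy => hzmin y hy
    have := hmin.inner_gradient_nonneg hargmin hz hy (hφdiff z)
    rw [hp, inner_neg_left, real_inner_smul_left]
    have := mul_nonneg (inv_pos.2 hc0).le this
    linarith
  have hterm : ∀ t ∈ Ici (0 : ℝ), ∀ w,
      β t * ((⟪(β t)⁻¹ • p, w⟫ - ψ w) - ⟪(β t)⁻¹ • p, z⟫) = ⟪p, w - z⟫ - β t * ψ w := by
    intro t ht w
    have := (hβpos t ht).ne'
    rw [real_inner_smul_left, real_inner_smul_left, inner_sub_right]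
    field_simp
    ring
  have hanti : AntitoneOn (fun t => ⨆ w : H,
      ENNReal.ofReal (β t * ((⟪(β t)⁻¹ • p, w⟫ - ψ w) - ⟪(β t)⁻¹ • p, z⟫))) (Ici 0) := by
    intro s hs t ht hst
    refine iSup_mono fun w => ENNReal.ofReal_le_ofReal ?_
    rw [hterm s hs, hterm t ht]
    have := mul_le_mul_of_nonneg_right (hβmono hs ht hst) (hψnonneg w)
    linarith
  obtain ⟨r, hr0, hr, hrint, hrlim⟩ := hanti.exists_integrableOn_tendsto_zero (hH z p hz hpN)
  have hrint : IntegrableOn r (Ioi 1) := hrint.mono_set (Ioi_subset_Ioi zero_le_one)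
  have hlower : ∀ t, 0 < t → 0 ≤ φ (x t) - φ z + c * (β t * ψ (x t)) + c * r t := by
    intro t ht
    have h1 := (le_iSup (fun w : H =>
      ENNReal.ofReal (β t * ((⟪(β t)⁻¹ • p, w⟫ - ψ w) - ⟪(β t)⁻¹ • p, z⟫))) (x t)).trans_eq
      (hr t ht)
    rw [hterm t ht.le, ENNReal.ofReal_le_ofReal_iff (hr0 t), hp, inner_neg_left,
      real_inner_smul_left] at h1
    have h2 := mul_le_mul_of_nonneg_left h1 hc0.le
    have h3 : c * (c⁻¹ * ⟪gradient φ z, x t - z⟫) = ⟪gradient φ z, x t - z⟫ := by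
      field_simp
    have h4 := hφconv.add_inner_gradient_le (hφdiff z) (x t)
    linarith
  -- derivatives in the interior
  have hβd : ∀ t, 1 ≤ t → HasDerivAt β (β' t) t := fun t ht =>
    (hβderiv t (zero_le_one.trans ht)).hasDerivAt (Ici_mem_nhds (one_pos.trans_le ht))
  have hxd : ∀ t, 1 ≤ t → HasDerivAt x (x' t) t := fun t ht =>
    (hx' t (zero_le_one.trans ht)).hasDerivAt (Ici_mem_nhds (one_pos.trans_le ht))
  have hx'd : ∀ t, 1 ≤ t → HasDerivAt x' (x'' t) t := fun t ht =>
    (hx'' t (zero_le_one.trans ht)).hasDerivAt (Ici_mem_nhds (one_pos.trans_le ht))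
  have hcompd : ∀ {f : H → ℝ}, Differentiable ℝ f → ∀ t, 1 ≤ t →
      HasDerivAt (fun t => f (x t)) ⟪gradient f (x t), x' t⟫ t := by
    intro f hf t ht
    rw [inner_gradient_left]
    exact (hf (x t)).hasFDerivAt.comp_hasDerivAt t (hxd t ht)
  have hode' : ∀ t, 1 ≤ t →
      x'' t = -(γ • x' t + gradient φ (x t) + β t • gradient ψ (x t)) := by
    intro t ht
    rw [eq_neg_iff_add_eq_zero, ← hode t (zero_le_one.trans ht)]
    abel
  -- the energy
  have hWd : ∀ t, 1 ≤ t → HasDerivAt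
      (fun t => ⟪x' t, x' t⟫ / 2 + (φ (x t) - φ z) + β t * ψ (x t))
      (-γ * ⟪x' t, x' t⟫ + β' t * ψ (x t)) t := by
    intro t ht
    have h := ((((hx'd t ht).inner ℝ (hx'd t ht)).div_const 2).add
      ((hcompd hφdiff t ht).sub_const (φ z))).add ((hβd t ht).mul (hcompd hψdiff t ht))
    refine h.congr_deriv ?_
    rw [hode' t ht]
    simp only [inner_neg_right, inner_add_right, real_inner_smul_right, real_inner_comm (x' t)]
    ring
  have hFd : ∀ t, 1 ≤ t → HasDerivAt
      (fun t => ⟪x' t, x' t⟫ / 2 + (φ (x t) - φ z) + β t * ψ (x t)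
        + (a * ⟪x' t, x t - z⟫ + a * γ / 2 * ⟪x t - z, x t - z⟫))
      (-(γ - a) * ⟪x' t, x' t⟫ + β' t * ψ (x t)
        - a * (⟪gradient φ (x t), x t - z⟫ + β t * ⟪gradient ψ (x t), x t - z⟫)) t := by
    intro t ht
    have hxz := (hxd t ht).sub_const z
    have h := (hWd t ht).add ((((hx'd t ht).inner ℝ hxz).const_mul a).add
      ((hxz.inner ℝ hxz).const_mul (a * γ / 2)))
    refine h.congr_deriv ?_
    rw [hode' t ht]
    simp only [inner_neg_left, inner_add_left, real_inner_smul_left,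
      real_inner_comm (x' t) (x t - z)]
    ring
  have hxc : ContinuousOn x (Ici 1) := fun t ht => (hxd t ht).continuousAt.continuousWithinAt
  have hx'c : ContinuousOn x' (Ici 1) := fun t ht => (hx'd t ht).continuousAt.continuousWithinAt
  have hβc : ContinuousOn β (Ici 1) := fun t ht => (hβd t ht).continuousAt.continuousWithinAt
  have hβ'c : ContinuousOn β' (Ici 1) := hβ'cont.mono (Ici_subset_Ici.2 zero_le_one)
  have hφc : ContinuousOn (fun t => φ (x t)) (Ici 1) := hφdiff.continuous.comp_continuousOn hxc
  have hψc : ContinuousOn (fun t => ψ (x t)) (Ici 1) := hψdiff.continuous.comp_continuousOn hxc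
  have huc : ContinuousOn (fun t => ⟪x' t, x' t⟫) (Ici 1) := hx'c.inner hx'c
  have hvc : ContinuousOn (fun t => β t * ψ (x t)) (Ici 1) := hβc.mul hψc
  have hu0 : ∀ t, 0 ≤ ⟪x' t, x' t⟫ := fun t => real_inner_self_nonneg
  have hv0 : ∀ t, 1 ≤ t → 0 ≤ β t * ψ (x t) := fun t ht =>
    mul_nonneg (hβpos t (zero_le_one.trans ht)).le (hψnonneg _)
  have hβψ : ∀ t, 1 ≤ t → 0 ≤ β' t * ψ (x t) ∧ β' t * ψ (x t) ≤ k * (β t * ψ (x t)) := by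
    intro t ht
    obtain ⟨h1, h2⟩ := hβgrowth t (zero_le_one.trans ht)
    refine ⟨mul_nonneg h1 (hψnonneg _), ?_⟩
    rw [← mul_assoc]
    exact mul_le_mul_of_nonneg_right h2 (hψnonneg _)
  have hQr : ∀ t, 1 ≤ t → (γ - a) * ⟪x' t, x' t⟫ + (a - k) / 2 * (β t * ψ (x t)) ≤
      ((γ - a) * ⟪x' t, x' t⟫ - k * (β t * ψ (x t)) + a * (φ (x t) - φ z + β t * ψ (x t)))
        + a * c * r t := by
    intro t ht
    have h := mul_nonneg ha.le (hlower t (one_pos.trans_le ht))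
    have h' : a * (φ (x t) - φ z + c * (β t * ψ (x t)) + c * r t) =
      a * (φ (x t) - φ z) + (a - k) / 2 * (β t * ψ (x t)) + a * c * r t := by rw [← hac]; ring
    linarith
  have hacr : IntegrableOn (fun t => a * c * r t) (Ioi 1) := hrint.const_mul (a * c)
  have hQ : IntegrableOn (fun t => (γ - a) * ⟪x' t, x' t⟫ - k * (β t * ψ (x t))
      + a * (φ (x t) - φ z + β t * ψ (x t))) (Ioi 1) := by
    refine integrableOn_Ioi_of_hasDerivAt_le_neg (m := mφ - φ z) hFd ?_ ?_ ?_ hacr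
      (fun t => mul_nonneg (mul_pos ha hc0).le (hr0 t)) ?_
    · intro t ht
      have h1 : 0 ≤ ⟪x' t + a • (x t - z), x' t + a • (x t - z)⟫ := real_inner_self_nonneg
      simp only [inner_add_left, inner_add_right, real_inner_smul_left, real_inner_smul_right,
        real_inner_comm (x' t) (x t - z)] at h1
      have h2 : 0 ≤ a * (γ - a) * ⟪x t - z, x t - z⟫ :=
        mul_nonneg (mul_nonneg ha.le (by linarith)) real_inner_self_nonneg
      have h3 := hφ_ge (x t)
      have h4 := hv0 t ht
      nlinarith
    · exact ((huc.const_mul (γ - a)).sub (hvc.const_mul k)).add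
        (((hφc.sub continuousOn_const).add hvc).const_mul a)
    · intro t ht
      have h1 := hφconv.add_inner_gradient_le (hφdiff (x t)) z
      have h2 := hψconv.add_inner_gradient_le (hψdiff (x t)) z
      rw [← neg_sub (x t) z, inner_neg_right] at h1 h2
      have h3 : β t * ψ (x t) ≤ β t * ⟪gradient ψ (x t), x t - z⟫ :=
        mul_le_mul_of_nonneg_left (by linarith) (hβpos t (zero_le_one.trans ht)).le
      have h4 := (hβψ t ht).2
      have h5 : a * (φ (x t) - φ z + β t * ψ (x t)) ≤
          a * (⟪gradient φ (x t), x t - z⟫ + β t * ⟪gradient ψ (x t), x t - z⟫) :=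
        mul_le_mul_of_nonneg_left (by linarith) ha.le
      linarith
    · intro t ht
      exact (add_nonneg (mul_nonneg (by linarith) (hu0 t))
        (mul_nonneg (by linarith) (hv0 t ht))).trans (hQr t ht)
  have hmeas : ∀ {f : ℝ → ℝ}, ContinuousOn f (Ici 1) →
      AEStronglyMeasurable f (volume.restrict (Ioi 1)) := fun hf =>
    (hf.mono Ioi_subset_Ici_self).aestronglyMeasurable measurableSet_Ioi
  have hu : IntegrableOn (fun t => ⟪x' t, x' t⟫) (Ioi 1) := by
    refine ((hQ.add hacr).const_mul (γ - a)⁻¹).mono' (hmeas huc) ?_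
    filter_upwards [ae_restrict_mem measurableSet_Ioi] with t ht
    rw [Real.norm_of_nonneg (hu0 t), le_inv_mul_iff₀ (by linarith)]
    have := mul_nonneg (by linarith : 0 ≤ (a - k) / 2) (hv0 t (le_of_lt ht))
    exact (by linarith : _ ≤ _).trans (hQr t (le_of_lt ht))
  have hv : IntegrableOn (fun t => β t * ψ (x t)) (Ioi 1) := by
    refine ((hQ.add hacr).const_mul ((a - k) / 2)⁻¹).mono' (hmeas hvc) ?_
    filter_upwards [ae_restrict_mem measurableSet_Ioi] with t ht
    rw [Real.norm_of_nonneg (hv0 t (le_of_lt ht)), le_inv_mul_iff₀ (by linarith)]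
    have := mul_nonneg (by linarith : 0 ≤ γ - a) (hu0 t)
    exact (by linarith : _ ≤ _).trans (hQr t (le_of_lt ht))
  have hW : Tendsto (fun t => ⟪x' t, x' t⟫ / 2 + (φ (x t) - φ z) + β t * ψ (x t)) atTop
      (nhds 0) := by
    refine tendsto_zero_of_hasDerivAt_of_integrableOn_Ioi (a := 1)
      (fun t ht => hWd t (le_of_lt ht)) ?_ ?_
    · refine (hu.const_mul (-γ)).add ((hv.const_mul k).mono' (hmeas (hβ'c.mul hψc)) ?_)
      filter_upwards [ae_restrict_mem measurableSet_Ioi] with t ht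
      rw [Real.norm_of_nonneg (hβψ t (le_of_lt ht)).1]
      exact (hβψ t (le_of_lt ht)).2
    · have h := ((hQ.add (hu.const_mul (a / 2 - (γ - a)))).add (hv.const_mul k)).const_mul a⁻¹
      refine h.congr (Eventually.of_forall fun t => ?_)
      simp only [Pi.add_apply]
      field_simp
      ring
  have hv_lim : Tendsto (fun t => β t * ψ (x t)) atTop (nhds 0) := by
    have hlim := (hW.add (hrlim.const_mul c)).const_mul 2
    simp only [mul_zero, add_zero] at hlim
    refine squeeze_zero' ?_ ?_ hlim
    · filter_upwards [eventually_ge_atTop 1] with t ht using hv0 t ht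
    · filter_upwards [eventually_ge_atTop 1] with t ht
      have h1 := hlower t (one_pos.trans_le ht)
      have h2 := mul_le_mul_of_nonneg_right hc1 (hv0 t ht)
      have h3 := hu0 t
      linarith
  refine ⟨hv_lim, squeeze_zero' (Eventually.of_forall fun t => hψnonneg _) ?_ hv_lim⟩
  filter_upwards [hβinf.eventually_ge_atTop 1] with t ht
  exact le_mul_of_one_le_left (hψnonneg _) ht
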